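/- Let X be an ℝ^d-valued random vector with density p: ℝ^d → (0,∞), and suppose there exist ρ > 0 and b ∈ [1,2] such that x ↦ log p(x) + ρ|x|^b is convex. Then for every θ ∈ ℝ^d, E[ e^{−2ρ|θ|^b} p(X)/p(X−θ) ] ≤ 1. -/

import Mathlib

open MeasureTheory
open scoped ENNReal

/-- A Clarkson-type inequality in an inner product space, for exponents `b ∈ [0, 2]`. -/
theorem norm_sub_rpow_add_norm_add_rpow_le {E : Type*} [NormedAddCommGroup E]
    [InnerProductSpace ℝ E] {b : ℝ} (hb₀ : 0 ≤ b) (hb₂ : b ≤ 2) (x y : E) :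
    ‖x - y‖ ^ b + ‖x + y‖ ^ b ≤ 2 * ‖x‖ ^ b + 2 * ‖y‖ ^ b := by
  have rpow_sq (z : E) : (‖z‖ ^ 2) ^ (b / 2) = ‖z‖ ^ b := by
    rw [← Real.rpow_natCast, ← Real.rpow_mul (norm_nonneg z)]
    congr 1
    push_cast
    ring
  have concave := (Real.concaveOn_rpow (p := b / 2) (by linarith) (by linarith)).2
    (Set.mem_Ici.2 (sq_nonneg ‖x - y‖)) (Set.mem_Ici.2 (sq_nonneg ‖x + y‖))
    (show (0 : ℝ) ≤ 1 / 2 by norm_num) (show (0 : ℝ) ≤ 1 / 2 by norm_num) (by norm_num)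
  have parallelogram :
      (1 / 2 : ℝ) • ‖x - y‖ ^ 2 + (1 / 2 : ℝ) • ‖x + y‖ ^ 2 = ‖x‖ ^ 2 + ‖y‖ ^ 2 := by
    have := parallelogram_law_with_norm ℝ x y
    simp only [smul_eq_mul]
    linarith
  have subadd := Real.rpow_add_le_add_rpow (sq_nonneg ‖x‖) (sq_nonneg ‖y‖)
    (p := b / 2) (by linarith) (by linarith)
  rw [parallelogram] at concave
  simp only [smul_eq_mul, rpow_sq] at concave subadd
  linarith

/-- If `log p + ρ|·|^b` is convex with `b ∈ [0, 2]`, then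
`p(x)² / p(x-θ) ≤ e^{2ρ|θ|^b} p(x+θ)`. -/
theorem mul_exp_mul_div_le_of_convexOn_log_add_rpow {E : Type*} [NormedAddCommGroup E]
    [InnerProductSpace ℝ E] {p : E → ℝ} (hp : ∀ x, 0 < p x) {ρ b : ℝ} (hρ : 0 ≤ ρ)
    (hb₀ : 0 ≤ b) (hb₂ : b ≤ 2)
    (hconv : ConvexOn ℝ Set.univ (fun x => Real.log (p x) + ρ * ‖x‖ ^ b)) (x θ : E) :
    p x * (Real.exp (-2 * ρ * ‖θ‖ ^ b) * (p x / p (x - θ))) ≤ p (x + θ) := by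
  have midpoint := hconv.2 (Set.mem_univ (x - θ)) (Set.mem_univ (x + θ))
    (show (0 : ℝ) ≤ 1 / 2 by norm_num) (show (0 : ℝ) ≤ 1 / 2 by norm_num) (by norm_num)
  have hx : (1 / 2 : ℝ) • (x - θ) + (1 / 2 : ℝ) • (x + θ) = x := by module
  simp only [hx, smul_eq_mul] at midpoint
  have clarkson := mul_le_mul_of_nonneg_left
    (norm_sub_rpow_add_norm_add_rpow_le hb₀ hb₂ x θ) hρ
  have hlog : Real.log (p x) + (-2 * ρ * ‖θ‖ ^ b + (Real.log (p x) - Real.log (p (x - θ))))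
      ≤ Real.log (p (x + θ)) := by linarith
  have := Real.exp_le_exp.2 hlog
  rwa [Real.exp_add, Real.exp_add, Real.exp_sub, Real.exp_log (hp _), Real.exp_log (hp _),
    Real.exp_log (hp _)] at this

/-- If `X` has an everywhere positive density `p` such that `x ↦ log p(x) + ρ|x|^b`
is convex for some `ρ > 0`, `b ∈ [1,2]`, then for every `θ`,
`E[e^{-2ρ|θ|^b} p(X)/p(X-θ)] ≤ 1`. -/
theorem stmt14 {d : ℕ} {Ω : Type*} [MeasurableSpace Ω] (P : Measure Ω) [IsProbabilityMeasure P]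
    (X : Ω → EuclideanSpace ℝ (Fin d)) (hX : Measurable X)
    (p : EuclideanSpace ℝ (Fin d) → ℝ)
    (hppos : ∀ x, 0 < p x) (hpmeas : Measurable p)
    (hlaw : Measure.map X P
      = MeasureTheory.volume.withDensity (fun x => ENNReal.ofReal (p x)))
    (ρ b : ℝ) (hρ : 0 < ρ) (hb : b ∈ Set.Icc (1 : ℝ) 2)
    (hconv : ConvexOn ℝ Set.univ (fun x => Real.log (p x) + ρ * ‖x‖ ^ b)) :
    ∀ θ : EuclideanSpace ℝ (Fin d),
      ∫⁻ ω, ENNReal.ofReal (Real.exp (-2 * ρ * ‖θ‖ ^ b) * (p (X ω) / p (X ω - θ))) ∂P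
        ≤ 1 := by
  intro θ
  have hmeas : Measurable fun x =>
      ENNReal.ofReal (Real.exp (-2 * ρ * ‖θ‖ ^ b) * (p x / p (x - θ))) := by fun_prop
  have htotal : ∫⁻ x, ENNReal.ofReal (p x) = 1 := by
    have := Measure.isProbabilityMeasure_map (μ := P) hX.aemeasurable
    rw [← setLIntegral_univ, ← withDensity_apply _ MeasurableSet.univ, ← hlaw, measure_univ]
  calc
    _ = ∫⁻ x, ENNReal.ofReal (Real.exp (-2 * ρ * ‖θ‖ ^ b) * (p x / p (x - θ)))
          ∂(Measure.map X P) := (lintegral_map hmeas hX).symm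
    _ = ∫⁻ x, ENNReal.ofReal (p x)
          * ENNReal.ofReal (Real.exp (-2 * ρ * ‖θ‖ ^ b) * (p x / p (x - θ))) := by
      rw [hlaw, lintegral_withDensity_eq_lintegral_mul _ hpmeas.ennreal_ofReal hmeas]
      rfl
    _ ≤ ∫⁻ x, ENNReal.ofReal (p (x + θ)) := by
      refine lintegral_mono fun x => ?_
      rw [← ENNReal.ofReal_mul (hppos x).le]
      exact ENNReal.ofReal_le_ofReal (mul_exp_mul_div_le_of_convexOn_log_add_rpow hppos hρ.le
        (by linarith [hb.1]) hb.2 hconv x θ)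
    _ = 1 := by rw [lintegral_add_right_eq_self (fun x => ENNReal.ofReal (p x)) θ, htotal]
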